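/- arXiv:0904.4600 — 5 statements merged into one kernel-verified Lean document; each statement's English description precedes it below -/
import Mathlib

section
/- Let k and n be integers with k ≤ n < 2k. Then χ_q(Q_{n/k}) = n/k if k is even, and χ_q(Q_{n/k}) = (n+1)/(k+1) if k is odd. -/
open scoped Classical

noncomputable section

/-- The circular complete graph `K_{p/q}`: vertices `v_0, …, v_{p-1}` with an edge
`v_i v_j` whenever `q ≤ |i - j| ≤ p - q`. -/
def circK (p q : ℕ) : SimpleGraph (Fin p) :=
  SimpleGraph.fromRel (fun i j =>
    q ≤ max i.val j.val - min i.val j.val ∧ max i.val j.val - min i.val j.val ≤ p - q)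

/-- The complete graph on two vertices. -/
def K2 : SimpleGraph (Fin 2) := ⊤

/-- The cycle graph on `n` vertices. -/
def cycleG (n : ℕ) : SimpleGraph (Fin n) :=
  SimpleGraph.fromRel (fun i j => (i.val + 1) % n = j.val)

/-- The total weight of the edges of `G` carried to edges of `H` by the vertex map `f`. -/
def cutWeight {α β : Type} [Fintype α] (G : SimpleGraph α) (H : SimpleGraph β)
    (w : Sym2 α → ℚ) (f : α → β) : ℝ :=
  ∑ e ∈ Finset.univ.filter (fun e : Sym2 α => e ∈ G.edgeSet ∧ Sym2.map f e ∈ H.edgeSet), (w e : ℝ)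

/-- `mc_H(G,w)`: the maximum over all vertex maps `f : V(G) → V(H)` of the total weight
of the edges of `G` mapped to edges of `H`. -/
def mcMax {α β : Type} [Fintype α] (H : SimpleGraph β) (G : SimpleGraph α)
    (w : Sym2 α → ℚ) : ℝ :=
  ⨆ f : α → β, cutWeight G H w f

/-- `s(M,N)`: the infimum over all finite simple graphs `G` with at least one edge and all
positive rational edge-weight functions `w` of `mc_M(G,w)/mc_N(G,w)`. -/
def sVal {α β : Type} (M : SimpleGraph α) (N : SimpleGraph β) : ℝ :=
  sInf { x : ℝ | ∃ (n : ℕ) (G : SimpleGraph (Fin n)) (w : Sym2 (Fin n) → ℚ),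
    G.edgeSet.Nonempty ∧ (∀ e ∈ G.edgeSet, 0 < w e) ∧
    x = mcMax M G w / mcMax N G w }

/-- An `H`-cut in `G`: the set of edges of `G` carried to edges of `H` by some vertex map. -/
def IsHCut {V W : Type} (G : SimpleGraph V) (H : SimpleGraph W) (X : Set (Sym2 V)) : Prop :=
  ∃ f : V → W, X = {e ∈ G.edgeSet | Sym2.map f e ∈ H.edgeSet}

/-- `χ_H(G)`: the infimum of `n/k` over all `H`-cut `n/k`-covers of `G`, i.e. collections
`X_1, …, X_n` of `H`-cuts in `G` such that every edge of `G` lies in at least `k` of them. -/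
def chiH {V W : Type} (H : SimpleGraph W) (G : SimpleGraph V) : ℝ :=
  sInf { x : ℝ | ∃ (n k : ℕ) (X : Fin n → Set (Sym2 V)), 0 < k ∧
    (∀ i, IsHCut G H (X i)) ∧
    (∀ e ∈ G.edgeSet, k ≤ (Finset.univ.filter (fun i => e ∈ X i)).card) ∧
    x = (n : ℝ) / (k : ℝ) }

/-- The graph `Q_{n/k}` on vertex set `{0,1}^n`, with `u` adjacent to `v` exactly when the
Hamming distance between `u` and `v` is at least `k`. -/
def qGraph (n k : ℕ) : SimpleGraph (Fin n → Bool) :=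
  SimpleGraph.fromRel (fun u v => k ≤ (Finset.univ.filter (fun i => u i ≠ v i)).card)

open Polynomial in
/-- signed polynomial -/
def PP (m d : ℕ) : Polynomial ℤ := (1 - X ^ 2) ^ m * (1 - X) ^ d

open Polynomial in
lemma comp_neg_X_coeff' (p : Polynomial ℤ) (i : ℕ) :
    (p.comp (-X)).coeff i = (-1)^i * p.coeff i := by
  have : (-X : Polynomial ℤ) = C (-1) * X := by simp
  rw [this, comp_C_mul_X_coeff, mul_comm]

lemma one_sub_pow_coeff (d i : ℕ) :
    ((1 - Polynomial.X) ^ d : Polynomial ℤ).coeff i = (-1)^i * (d.choose i : ℤ) := by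
  have h : ((1 - Polynomial.X) ^ d : Polynomial ℤ)
      = ((1 + Polynomial.X) ^ d : Polynomial ℤ).comp (-Polynomial.X) := by
    simp [sub_eq_add_neg]
  rw [h, comp_neg_X_coeff', Polynomial.coeff_one_add_X_pow]

open Polynomial in
lemma PP_zero_coeff (d j : ℕ) : |(PP 0 d).coeff j| = (d.choose j : ℤ) := by
  have h : (PP 0 d) = ((1 + X) ^ d : Polynomial ℤ).comp (-X) := by
    simp [PP, sub_eq_add_neg]
  rw [h, comp_neg_X_coeff']
  simp [coeff_one_add_X_pow, abs_mul]

open Polynomial in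
lemma PP_succ_coeff (m d j : ℕ) :
    (PP (m+1) d).coeff (j+2) = (PP m d).coeff (j+2) - (PP m d).coeff j := by
  have h : PP (m+1) d = PP m d - PP m d * X ^ 2 := by simp [PP]; ring
  rw [h, coeff_sub, coeff_mul_X_pow]

open Polynomial in
lemma PP_succ_coeff_lt (m d j : ℕ) (hj : j < 2) :
    (PP (m+1) d).coeff j = (PP m d).coeff j := by
  have h : PP (m+1) d = PP m d - PP m d * X ^ 2 := by simp [PP]; ring
  rw [h, coeff_sub, coeff_mul_X_pow']
  simp [hj]

lemma choose_two (a j : ℕ) :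
    (a+2).choose (j+2) = a.choose j + 2 * a.choose (j+1) + a.choose (j+2) := by
  simp [Nat.choose_succ_succ]; ring

lemma PP_abs_le (m d j : ℕ) : |(PP m d).coeff j| ≤ ((2*m+d).choose j : ℤ) := by
  induction m generalizing j with
  | zero => rw [PP_zero_coeff]; simp
  | succ m ih =>
    have e : 2*(m+1)+d = 2*m+d+2 := by ring
    rw [e]
    match j with
    | 0 => rw [PP_succ_coeff_lt _ _ _ (by norm_num)]; simpa using ih 0
    | 1 =>
      rw [PP_succ_coeff_lt _ _ _ (by norm_num)]
      have := ih 1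
      simp at this ⊢; linarith
    | j+2 =>
      rw [PP_succ_coeff, choose_two]
      have := abs_sub (G := ℤ) ((PP m d).coeff (j+2)) ((PP m d).coeff j)
      have h1 := ih (j+2)
      have h2 := ih j
      push_cast
      have : (0:ℤ) ≤ ((2*m+d).choose (j+1) : ℤ) := by positivity
      linarith

/-- ratio bound -/
lemma choose_key (a j : ℕ) (h : j + 1 ≤ a) :
    a.choose j + a.choose (j+2) ≤ a * a.choose (j+1) := by
  have h1 := Nat.choose_succ_right_eq a (j+1)
  have h2 := Nat.choose_succ_right_eq a j
  obtain ⟨b, rfl⟩ := Nat.exists_eq_add_of_le h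
  have e1 : j + 1 + b - (j+1) = b := by omega
  have e2 : j + 1 + b - j = b + 1 := by omega
  rw [e1] at h1
  rw [e2] at h2
  nlinarith [Nat.zero_le ((j+1+b).choose (j+1+1) * j), Nat.zero_le ((j+1+b).choose j * b),
    Nat.zero_le ((j+1+b).choose (j+1+1))]

lemma choose_two_val (a : ℕ) : (2 * (a+1).choose 2 : ℤ) = (a+1) * a := by
  have := Nat.triangle_succ a
  have h := Nat.choose_succ_right_eq (a+1) 1
  simp at h
  have h' : ((a+1).choose 2 * 2 : ℤ) = (a+1) * a := by exact_mod_cast h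
  linarith

lemma PP_bound (d : ℕ) (hd : 1 ≤ d) (m j : ℕ) (h : m = 0 ∨ (1 ≤ j ∧ j ≠ 2*m+d)) :
    ((2*m+d : ℕ) : ℤ) * |(PP m d).coeff j| ≤ d * ((2*m+d).choose j : ℤ) := by
  induction m generalizing j with
  | zero => rw [PP_zero_coeff]; simp
  | succ m ih =>
    have e : 2*(m+1)+d = 2*m+d+2 := by ring
    rw [e] at h ⊢
    have hj : 1 ≤ j ∧ j ≠ 2*m+d+2 := by
      rcases h with h | h
      · omega
      · exact h
    obtain ⟨hj1, hj2⟩ := hj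
    have hdz : (1:ℤ) ≤ d := by exact_mod_cast hd
    match j with
    | 0 => omega
    | 1 =>
      rw [PP_succ_coeff_lt _ _ _ (by norm_num)]
      have := ih 1 (by omega)
      simp only [Nat.choose_one_right] at this ⊢
      have hp : (0:ℤ) < ((2*m+d : ℕ) : ℤ) := by exact_mod_cast (by omega)
      have h3 : |(PP m d).coeff 1| ≤ d := by nlinarith
      rw [mul_comm]
      exact mul_le_mul_of_nonneg_right h3 (by positivity)
    | j+2 =>
      rw [PP_succ_coeff]
      have hab := abs_sub (G := ℤ) ((PP m d).coeff (j+2)) ((PP m d).coeff j)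
      generalize hA : |(PP m d).coeff (j+2)| = A at *
      generalize hB : |(PP m d).coeff j| = B at *
      generalize hC : |(PP m d).coeff (j+2) - (PP m d).coeff j| = C at *
      by_cases hgt : 2*m+d < j+1
      · have hA0 := PP_abs_le m d (j+2)
        have hB0 := PP_abs_le m d j
        rw [hA, Nat.choose_eq_zero_of_lt (by omega)] at hA0
        have hjj : j = 2*m+d ∨ 2*m+d < j := by omega
        rcases hjj with hjj | hjj
        · omega
        · rw [hB, Nat.choose_eq_zero_of_lt hjj] at hB0
          have : C ≤ 0 := by push_cast at *; linarith
          have h1 : ((2*m+d+2 : ℕ):ℤ) * C ≤ 0 := mul_nonpos_of_nonneg_of_nonpos (by positivity) this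
          exact h1.trans (by positivity)
      · push Not at hgt
        by_cases hedge : m ≠ 0 ∧ (j = 0 ∨ j + 2 = 2*m+d)
        · obtain ⟨hm, hj⟩ := hedge
          obtain ⟨a, ha⟩ : ∃ a, 2*m+d = a+1 := ⟨2*m+d-1, by omega⟩
          have c1 := choose_two_val a
          have c2 := choose_two_val (a+2)
          have ha2 : 2 ≤ a := by omega
          have hAB : ((a+1 : ℕ):ℤ) * (A + B - 1) ≤ d * ((a+1).choose 2 : ℤ)
              ∧ ((a+3).choose (j+2)) = (a+3).choose 2 := by
            rcases hj with rfl | hj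
            · have hB0 := PP_abs_le m d 0
              rw [hB] at hB0
              simp at hB0
              have := ih 2 (by omega)
              rw [show |(PP m d).coeff 2| = A from hA, ha] at this
              refine ⟨?_, rfl⟩
              nlinarith
            · have hA0 := PP_abs_le m d (j+2)
              rw [hA, hj, Nat.choose_self] at hA0
              have := ih j (by omega)
              rw [hB, ha] at this
              have e1 : (a+1).choose j = (a+1).choose 2 :=
                Nat.choose_symm_of_eq_add (by omega)
              rw [e1] at this
              refine ⟨?_, Nat.choose_symm_of_eq_add (by omega)⟩
              push_cast at *
              nlinarith
          obtain ⟨h1, h2⟩ := hAB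
          rw [ha, show a+1+2 = a+3 by ring, h2]
          push_cast at *
          have hapos : (0:ℤ) < (a:ℤ)+1 := by positivity
          have h3 : 2 * (A + B - 1) ≤ d * a := by
            have : ((a:ℤ)+1) * (2*(A+B-1)) ≤ (a+1) * (d*a) := by nlinarith
            exact le_of_mul_le_mul_left this hapos
          have c2' : (2:ℤ) * ((a+3).choose 2 : ℤ) = (a+3)*(a+2) := by
            rw [show a+3 = a+2+1 by ring, c2]; ring
          have h4 : 2 * C ≤ d * (a+2) := by linarith
          have h5 : ((a:ℤ)+3) * (2*C) ≤ (a+3) * (d*(a+2)) :=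
            mul_le_mul_of_nonneg_left h4 (by positivity)
          have h6 : (d:ℤ) * (2 * ((a+3).choose 2 : ℤ)) = d * ((a+3)*(a+2)) := by rw [c2']
          linarith
        · have hA1 := ih (j+2) (by omega)
          have hB1 := ih j (by omega)
          rw [hA] at hA1
          rw [hB] at hB1
          have key := choose_key (2*m+d) j hgt
          rw [choose_two]
          generalize 2*m+d = a at *
          generalize a.choose j = x at *
          generalize a.choose (j+1) = y at *
          generalize a.choose (j+2) = z at *
          have keyz : (x:ℤ) + z ≤ a * y := by exact_mod_cast key
          have hapos : (0:ℤ) < a := by exact_mod_cast (by omega)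
          push_cast
          have h1 : (a:ℤ) * C ≤ d * (x + z) := by nlinarith
          have h2 : (a:ℤ) * (((a:ℤ)+2) * C) ≤ a * (d * (x + 2*y + z)) := by
            have t1 : ((a:ℤ)+2) * (a * C) ≤ (a+2) * (d * (x+z)) :=
              mul_le_mul_of_nonneg_left h1 (by positivity)
            have t2 : (d:ℤ) * (x+z) ≤ d * (a*y) := mul_le_mul_of_nonneg_left keyz (by positivity)
            nlinarith
          exact le_of_mul_le_mul_left h2 hapos

open Polynomial in
/-- Krawtchouk coefficient -/
def kr (n k j : ℕ) : ℤ := ((1 - X) ^ j * (1 + X) ^ (n - j) : Polynomial ℤ).coeff k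

open Polynomial in
lemma kr_eq (n k j : ℕ) :
    kr n k j = ∑ i ∈ Finset.range (k+1), (-1)^i * (j.choose i : ℤ) * ((n-j).choose (k-i) : ℤ) := by
  rw [kr, coeff_mul, Finset.Nat.sum_antidiagonal_eq_sum_range_succ_mk]
  refine Finset.sum_congr rfl fun i _ => ?_
  simp only [one_sub_pow_coeff, coeff_one_add_X_pow]

lemma choose_sym (n k j i : ℕ) (hk : k ≤ n) (hj : j ≤ n) (hik : i ≤ k) (hij : i ≤ j) :
    n.choose j * (j.choose i * (n-j).choose (k-i)) =
    n.choose k * (k.choose i * (n-k).choose (j-i)) := by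
  rw [← mul_assoc, ← mul_assoc, Nat.choose_mul hij, Nat.choose_mul hik, mul_assoc, mul_assoc]
  congr 1
  by_cases h : k - i ≤ n - j
  · have a1 := Nat.choose_mul (n := n-i) (k := (j-i)+(k-i)) (s := j-i) (by omega)
    have a2 := Nat.choose_mul (n := n-i) (k := (j-i)+(k-i)) (s := k-i) (by omega)
    rw [show n - i - (j-i) = n - j by omega, show j-i+(k-i)-(j-i) = k-i by omega] at a1
    rw [show n - i - (k-i) = n - k by omega, show j-i+(k-i)-(k-i) = j-i by omega] at a2
    rw [← a1, ← a2]
    congr 1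
    exact Nat.choose_symm_of_eq_add (by omega)
  · rw [Nat.choose_eq_zero_of_lt (by omega : n - j < k - i),
      Nat.choose_eq_zero_of_lt (by omega : n - k < j - i)]
    simp

lemma kr_eq' (n k j : ℕ) :
    kr n k j = ∑ i ∈ Finset.range (min k j + 1),
      (-1)^i * (j.choose i : ℤ) * ((n-j).choose (k-i) : ℤ) := by
  rw [kr_eq]
  symm
  apply Finset.sum_subset
  · intro i; simp; omega
  · intro i h1 h2
    simp at h1 h2
    rw [Nat.choose_eq_zero_of_lt (by omega : j < i)]
    simp

lemma kr_sym (n k j : ℕ) (hk : k ≤ n) (hj : j ≤ n) :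
    (n.choose j : ℤ) * kr n k j = n.choose k * kr n j k := by
  rw [kr_eq', kr_eq', min_comm j k, Finset.mul_sum, Finset.mul_sum]
  refine Finset.sum_congr rfl fun i hi => ?_
  simp at hi
  have := choose_sym n k j i hk hj (by omega) (by omega)
  have h' : (n.choose j : ℤ) * (j.choose i * (n-j).choose (k-i)) =
    n.choose k * (k.choose i * (n-k).choose (j-i)) := by exact_mod_cast this
  linear_combination (-1)^i * h'

open Polynomial in
lemma kr_bound (n k j : ℕ) (h1 : k ≤ n) (h2 : n < 2*k) (hk : Even k) (hj : j ≤ n) :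
    0 ≤ (n:ℤ) * kr n k j + (2*k-n) * n.choose k := by
  have hd : (0:ℤ) < 2*k-n := by
    have : (n:ℤ) < 2*k := by exact_mod_cast h2
    linarith
  by_cases h0 : j = 0 ∨ j = n
  · have : 0 ≤ kr n k j := by
      rcases h0 with rfl | rfl
      · simp [kr, coeff_one_add_X_pow]
      · rw [kr]
        rw [Nat.sub_self, pow_zero, mul_one, one_sub_pow_coeff, hk.neg_one_pow]
        simp
    positivity
  · push Not at h0
    have hs := kr_sym n k j h1 hj
    have hP : kr n j k = (PP (n-k) (2*k-n)).coeff j := by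
      rw [kr, PP]
      congr 1
      conv_lhs => rw [show k = (n-k) + (2*k-n) by omega]
      rw [show n - (n-k + (2*k-n)) = n-k by omega, pow_add,
        show (1 - X^2 : Polynomial ℤ) = (1-X)*(1+X) by ring, mul_pow]
      ring
    have hb := PP_bound (2*k-n) (by omega) (n-k) j (by omega)
    rw [← hP, show 2*(n-k)+(2*k-n) = n by omega] at hb
    have hc : (((2*k-n : ℕ)) : ℤ) = 2*k-n := by
      rw [Nat.cast_sub (by omega)]; push_cast; ring
    rw [hc] at hb
    have hab := neg_abs_le (kr n j k)
    have hcj : (0:ℤ) < n.choose j := by exact_mod_cast Nat.choose_pos hj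
    have hck : (0:ℤ) < n.choose k := by exact_mod_cast Nat.choose_pos h1
    have h3 : -((2*k-n) * (n.choose j : ℤ)) ≤ n * kr n j k := by
      have : (n:ℤ) * (-|kr n j k|) ≤ n * kr n j k := mul_le_mul_of_nonneg_left hab (by positivity)
      linarith
    have h4 : 0 ≤ (n.choose j : ℤ) * ((n:ℤ) * kr n k j + (2*k-n) * n.choose k) := by
      have : (n.choose j : ℤ) * ((n:ℤ) * kr n k j + (2*k-n) * n.choose k)
        = n.choose k * (n * kr n j k + (2*k-n) * n.choose j) := by
        linear_combination (n:ℤ) * hs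
      rw [this]
      apply mul_nonneg hck.le; linarith
    exact nonneg_of_mul_nonneg_right h4 hcj

/-- characters -/
def chr {n : ℕ} (J u : Fin n → Bool) : ℤ := ∏ i, if J i && u i then -1 else 1

/-- weight -/
def wt {n : ℕ} (u : Fin n → Bool) : ℕ := (Finset.univ.filter (fun i => u i = true)).card

/-- addition -/
def xr {n : ℕ} (u v : Fin n → Bool) : Fin n → Bool := fun i => xor (u i) (v i)

lemma xr_xr {n : ℕ} (u v : Fin n → Bool) : xr u (xr u v) = v := by
  ext i; simp [xr]

lemma chr_xr {n : ℕ} (J u v : Fin n → Bool) : chr J (xr u v) = chr J u * chr J v := by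
  rw [chr, chr, chr, ← Finset.prod_mul_distrib]
  refine Finset.prod_congr rfl fun i _ => ?_
  simp only [xr]
  rcases Bool.eq_false_or_eq_true (J i) with hJ | hJ <;>
  rcases Bool.eq_false_or_eq_true (u i) with hu | hu <;>
  rcases Bool.eq_false_or_eq_true (v i) with hv | hv <;> simp [hJ, hu, hv]

lemma sum_chr {n : ℕ} (w : Fin n → Bool) :
    ∑ J, chr J w = if w = fun _ => false then 2^n else 0 := by
  have h := Finset.prod_univ_sum (fun _ : Fin n => (Finset.univ : Finset Bool))
    (fun i b => if b && w i then (-1:ℤ) else 1)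
  rw [Fintype.piFinset_univ] at h
  simp only [chr]
  rw [← h]
  split_ifs with hw
  · subst hw; simp
  · have : ∃ i, w i = true := by
      by_contra hc
      push Not at hc
      exact hw (by ext i; simpa using hc i)
    obtain ⟨i, hi⟩ := this
    exact Finset.prod_eq_zero (Finset.mem_univ i) (by simp [hi])

open Polynomial in
lemma sum_wt {n : ℕ} (J : Fin n → Bool) (k : ℕ) :
    ∑ s with wt s = k, chr J s = kr n k (wt J) := by
  have h := Finset.prod_univ_sum (fun _ : Fin n => (Finset.univ : Finset Bool))
    (fun i b => (if b then (if J i then -X else X) else 1 : Polynomial ℤ))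
  rw [Fintype.piFinset_univ] at h
  have hL : ∏ i, ∑ b : Bool, (if b then (if J i then -X else X) else 1 : Polynomial ℤ)
      = (1 - X) ^ (wt J) * (1 + X) ^ (n - wt J) := by
    have : ∀ i, ∑ b : Bool, (if b then (if J i then -X else X) else 1 : Polynomial ℤ)
      = if J i = true then 1 - X else 1 + X := by
      intro i; cases J i <;> simp <;> ring
    simp only [this]
    rw [Finset.prod_ite, Finset.prod_const, Finset.prod_const]
    have := Finset.card_filter_add_card_filter_not (s := (Finset.univ : Finset (Fin n)))
      (fun i => J i = true)
    simp only [Finset.card_univ, Fintype.card_fin] at this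
    congr 2
    simp only [wt]; omega
  have hR : ∀ s : Fin n → Bool,
      ∏ i, (if s i then (if J i then -X else X) else 1 : Polynomial ℤ)
      = C (chr J s) * X ^ (wt s) := by
    intro s
    have e1 : (X : Polynomial ℤ) ^ (wt s) = ∏ i, if s i = true then X else 1 := by
      rw [Finset.prod_ite]; simp [wt]
    rw [e1, chr, map_prod, ← Finset.prod_mul_distrib]
    refine Finset.prod_congr rfl fun i _ => ?_
    cases J i <;> cases s i <;> simp
  rw [hL] at h
  simp only [hR] at h
  rw [kr, h, finsetSum_coeff]
  simp only [coeff_C_mul_X_pow]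
  rw [Finset.sum_filter]
  refine Finset.sum_congr rfl fun s _ => ?_
  simp [eq_comm]

lemma card_wt (n k : ℕ) :
    (((Finset.univ : Finset (Fin n → Bool)).filter (fun s => wt s = k)).card : ℤ)
      = n.choose k := by
  have h := sum_wt (fun _ : Fin n => false) k
  simpa [chr, wt, kr, Polynomial.coeff_one_add_X_pow] using h

lemma wt_le {n : ℕ} (J : Fin n → Bool) : wt J ≤ n := by
  simpa [wt] using Finset.card_filter_le (Finset.univ : Finset (Fin n)) (fun i => J i = true)

lemma fourierId {n : ℕ} (f : (Fin n → Bool) → ℤ) (s : Fin n → Bool) :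
    ∑ J, (∑ u, chr J u * f u)^2 * chr J s = 2^n * ∑ u, f u * f (xr u s) := by
  have : ∀ J : Fin n → Bool, (∑ u, chr J u * f u)^2 * chr J s
      = ∑ u, ∑ v, f u * f v * chr J (xr (xr u s) v) := by
    intro J
    rw [sq, Finset.sum_mul_sum, Finset.sum_mul]
    refine Finset.sum_congr rfl fun u _ => ?_
    rw [Finset.sum_mul]
    refine Finset.sum_congr rfl fun v _ => ?_
    rw [chr_xr, chr_xr]; ring
  simp only [this]
  rw [Finset.sum_comm, Finset.mul_sum]
  refine Finset.sum_congr rfl fun u _ => ?_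
  rw [Finset.sum_comm, Finset.sum_eq_single (xr u s)]
  · rw [← Finset.mul_sum, sum_chr, if_pos]
    · ring
    · ext i; simp [xr]
  · intro v _ hv
    rw [← Finset.mul_sum, sum_chr, if_neg, mul_zero]
    intro h
    apply hv
    ext i
    have := congrFun h i
    simp only [xr] at this ⊢
    revert this
    cases u i <;> cases v i <;> cases s i <;> simp
  · simp

lemma quad (n k : ℕ) (h1 : k ≤ n) (h2 : n < 2*k) (hk : Even k) (f : (Fin n → Bool) → ℤ)
    (hf : ∀ u, f u * f u = 1) :
    0 ≤ (n:ℤ) * (∑ s with wt s = k, ∑ u, f u * f (xr u s)) + (2*k-n) * n.choose k * 2^n := by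
  have hpos : 0 ≤ ∑ J : Fin n → Bool, (∑ u, chr J u * f u)^2 *
      ((n:ℤ) * kr n k (wt J) + (2*k-n) * n.choose k) :=
    Finset.sum_nonneg fun J _ => mul_nonneg (sq_nonneg _) (kr_bound n k _ h1 h2 hk (wt_le J))
  have hA : ∑ J : Fin n → Bool, (∑ u, chr J u * f u)^2 * kr n k (wt J)
      = 2^n * ∑ s with wt s = k, ∑ u, f u * f (xr u s) := by
    simp only [← sum_wt, Finset.mul_sum _ _ ((_ : ℤ)^2)]
    rw [Finset.sum_comm, Finset.mul_sum]
    exact Finset.sum_congr rfl fun s _ => fourierId f s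
  have hB : ∑ J : Fin n → Bool, (∑ u, chr J u * f u)^2 = 2^n * 2^n := by
    have := fourierId f (fun _ => false)
    have hx : ∀ u : Fin n → Bool, xr u (fun _ => false) = u := by
      intro u; ext i; simp [xr]
    have hc : ∀ J : Fin n → Bool, chr J (fun _ => false) = 1 := by
      intro J; simp [chr]
    simp only [hx, hc, hf, mul_one] at this
    rw [this]; simp
  have hE : ∑ J : Fin n → Bool, (∑ u, chr J u * f u)^2 *
      ((n:ℤ) * kr n k (wt J) + (2*k-n) * n.choose k) =
      2^n * ((n:ℤ) * (∑ s with wt s = k, ∑ u, f u * f (xr u s)) + (2*k-n) * n.choose k * 2^n) := by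
    have : ∀ J : Fin n → Bool, (∑ u, chr J u * f u)^2 *
      ((n:ℤ) * kr n k (wt J) + (2*k-n) * n.choose k) =
      n * ((∑ u, chr J u * f u)^2 * kr n k (wt J))
        + (2*k-n) * n.choose k * (∑ u, chr J u * f u)^2 := fun J => by ring
    simp only [this]
    rw [Finset.sum_add_distrib, ← Finset.mul_sum, ← Finset.mul_sum, hA, hB]
    ring
  rw [hE] at hpos
  exact nonneg_of_mul_nonneg_right hpos (by positivity)

lemma cut_bound (n k : ℕ) (h1 : k ≤ n) (h2 : n < 2*k) (hk : Even k)
    (g : (Fin n → Bool) → Fin 2) :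
    (n:ℤ) * (∑ s with wt s = k, ∑ u, if g u ≠ g (xr u s) then 1 else 0)
      ≤ k * (n.choose k * 2^n) := by
  have hq := quad n k h1 h2 hk (fun u => if g u = 0 then 1 else -1)
    (fun u => by split_ifs <;> norm_num)
  have : ∀ u v : Fin n → Bool, ((if g u = 0 then 1 else -1) * (if g v = 0 then 1 else -1) : ℤ)
      = 1 - 2 * (if g u ≠ g v then 1 else 0) := by
    intro u v
    generalize g u = a
    generalize g v = b
    fin_cases a <;> fin_cases b <;> simp
  simp only [this, Finset.sum_sub_distrib, ← Finset.mul_sum] at hq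
  have hc : (∑ s : Fin n → Bool with wt s = k, ∑ u : Fin n → Bool, (1:ℤ)) = n.choose k * 2^n := by
    simp [card_wt]
  rw [hc] at hq
  linarith

lemma lower (n k : ℕ) (h1 : k ≤ n) (h2 : n < 2*k) (hk : Even k) (N K : ℕ)
    (f : Fin N → (Fin n → Bool) → Fin 2)
    (hf : ∀ u v : Fin n → Bool, k ≤ (Finset.univ.filter (fun i => u i ≠ v i)).card →
      K ≤ (Finset.univ.filter (fun i => f i u ≠ f i v)).card) : n * K ≤ k * N := by
  have hup : ∑ i : Fin N,
      (n:ℤ) * (∑ s with wt s = k, ∑ u, if f i u ≠ f i (xr u s) then 1 else 0)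
      ≤ ∑ i : Fin N, (k:ℤ) * (n.choose k * 2^n) :=
    Finset.sum_le_sum fun i _ => cut_bound n k h1 h2 hk (f i)
  have hlow : (n.choose k * 2^n : ℤ) * K ≤
      ∑ i : Fin N, (∑ s with wt s = k, ∑ u, if f i u ≠ f i (xr u s) then (1:ℤ) else 0) := by
    rw [Finset.sum_comm]
    have : (n.choose k * 2^n : ℤ) * K
        = ∑ s : Fin n → Bool with wt s = k, ∑ u : Fin n → Bool, (K:ℤ) := by
      simp [card_wt]; ring
    rw [this]
    refine Finset.sum_le_sum fun s hs => ?_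
    rw [Finset.sum_comm]
    refine Finset.sum_le_sum fun u _ => ?_
    have hs' : wt s = k := by simpa using hs
    have := hf u (xr u s) (by
      rw [← hs', wt]
      apply le_of_eq
      congr 1
      ext i
      rw [Finset.mem_filter, Finset.mem_filter]
      simp only [xr, Finset.mem_univ, true_and]
      cases u i <;> cases s i <;> simp)
    rw [Finset.sum_boole]
    exact_mod_cast this
  rw [← Finset.mul_sum] at hup
  simp only [Finset.sum_const, Finset.card_univ, Fintype.card_fin, nsmul_eq_mul] at hup
  have hcp : (0:ℤ) < n.choose k * 2^n := by
    have := Nat.choose_pos h1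
    positivity
  have h3 := mul_le_mul_of_nonneg_left hlow (by positivity : (0:ℤ) ≤ n)
  have h4 : (n.choose k * 2^n : ℤ) * (n * K : ℤ) ≤ (n.choose k * 2^n : ℤ) * (k * N : ℤ) := by
    linarith
  exact_mod_cast le_of_mul_le_mul_left h4 hcp

lemma lower_odd (n k : ℕ) (h1 : k ≤ n) (h2 : n < 2*k) (hk : Odd k) (N K : ℕ)
    (f : Fin N → (Fin n → Bool) → Fin 2)
    (hf : ∀ u v : Fin n → Bool, k ≤ (Finset.univ.filter (fun i => u i ≠ v i)).card →
      K ≤ (Finset.univ.filter (fun i => f i u ≠ f i v)).card) : (n+1) * K ≤ (k+1) * N := by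
  refine lower (n+1) (k+1) (by omega) (by omega) hk.add_one N K
    (fun i u => f i (fun t => u t.succ)) ?_
  intro u v huv
  apply hf
  rw [Fin.card_filter_univ_succ] at huv
  split_ifs at huv <;> omega

lemma q_adj {n k : ℕ} (hk : 0 < k) (u v : Fin n → Bool) :
    (qGraph n k).Adj u v ↔ k ≤ (Finset.univ.filter (fun i => u i ≠ v i)).card := by
  rw [qGraph, SimpleGraph.fromRel_adj]
  constructor
  · rintro ⟨_, h | h⟩
    · exact h
    · simpa only [ne_comm] using h
  · intro h
    refine ⟨?_, Or.inl h⟩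
    rintro rfl
    simp at h; omega

lemma chi_lower (n k a b : ℕ) (hk : 0 < k) (hb : 0 < b)
    (hl : ∀ (N K : ℕ) (f : Fin N → (Fin n → Bool) → Fin 2),
      (∀ u v : Fin n → Bool, k ≤ (Finset.univ.filter (fun i => u i ≠ v i)).card →
        K ≤ (Finset.univ.filter (fun i => f i u ≠ f i v)).card) → a * K ≤ b * N)
    (hu : ∃ f : Fin a → (Fin n → Bool) → Fin 2,
      (∀ u v : Fin n → Bool, k ≤ (Finset.univ.filter (fun i => u i ≠ v i)).card →
        b ≤ (Finset.univ.filter (fun i => f i u ≠ f i v)).card)) :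
    chiH K2 (qGraph n k) = (a : ℝ) / b := by
  apply IsLeast.csInf_eq
  constructor
  · obtain ⟨f, hf⟩ := hu
    refine ⟨a, b, fun i => {e ∈ (qGraph n k).edgeSet | Sym2.map (f i) e ∈ K2.edgeSet}, hb,
      fun i => ⟨f i, rfl⟩, ?_, rfl⟩
    intro e he
    induction e with | _ u v
    have he' := he
    rw [SimpleGraph.mem_edgeSet, q_adj hk] at he'
    refine (hf u v he').trans (le_of_eq ?_)
    congr 1
    ext i
    simp only [Finset.mem_filter, Set.mem_ofPred_eq, he]
    simp [K2]
  · rintro x ⟨N, K, X, hK, hX, hc, rfl⟩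
    choose f hf using hX
    have := hl N K f (by
      intro u v huv
      have he : s(u,v) ∈ (qGraph n k).edgeSet := by
        rw [SimpleGraph.mem_edgeSet, q_adj hk]; exact huv
      refine (hc _ he).trans (le_of_eq ?_)
      congr 1
      ext i
      rw [Finset.mem_filter, hf i]
      simp only [Finset.mem_filter, Set.mem_ofPred_eq, he]
      simp [K2])
    rw [div_le_div_iff₀ (by positivity) (by positivity)]
    have h' : ((a * K : ℕ) : ℝ) ≤ ((b * N : ℕ) : ℝ) := by exact_mod_cast this
    push_cast at h'
    linarith

/-- bit as element of Fin 2 -/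
def bt (b : Bool) : Fin 2 := if b then 1 else 0

lemma bt_ne (a b : Bool) : bt a ≠ bt b ↔ a ≠ b := by cases a <;> cases b <;> simp [bt]

lemma parity {n : ℕ} (u v : Fin n → Bool) :
    (wt u + wt v) % 2 = (Finset.univ.filter (fun i => u i ≠ v i)).card % 2 := by
  have : ∃ c, wt u + wt v = (Finset.univ.filter (fun i => u i ≠ v i)).card + 2 * c := by
    refine ⟨(Finset.univ.filter (fun i => u i = true ∧ v i = true)).card, ?_⟩
    simp only [wt, Finset.card_filter]
    rw [Finset.mul_sum, ← Finset.sum_add_distrib, ← Finset.sum_add_distrib]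
    refine Finset.sum_congr rfl fun i _ => ?_
    cases u i <;> cases v i <;> simp
  omega

theorem stmt12 (n k : ℕ) (h1 : k ≤ n) (h2 : n < 2*k) :
    (Even k → chiH K2 (qGraph n k) = (n : ℝ) / (k : ℝ)) ∧
    (Odd k → chiH K2 (qGraph n k) = ((n : ℝ)+1) / ((k : ℝ)+1)) := by
  have hk0 : 0 < k := by omega
  constructor
  · intro hk
    refine chi_lower n k n k hk0 hk0 (fun N K f hf => lower n k h1 h2 hk N K f hf)
      ⟨fun i u => bt (u i), fun u v h => ?_⟩
    simpa only [bt_ne] using h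
  · intro hk
    have := chi_lower n k (n+1) (k+1) hk0 (by omega)
      (fun N K f hf => lower_odd n k h1 h2 hk N K f hf)
      ⟨Fin.cons (fun u => bt (decide (wt u % 2 = 1))) (fun i u => bt (u i)), fun u v h => ?_⟩
    · exact_mod_cast this
    · rw [Fin.card_filter_univ_succ]
      simp only [Fin.cons_zero, Fin.cons_succ, bt_ne]
      have hp := parity u v
      split_ifs with hc
      · omega
      · have hc' : (wt u % 2 = 1) ↔ (wt v % 2 = 1) := by simpa using hc
        obtain ⟨c, hc2⟩ := hk
        rcases Nat.lt_or_ge k (Finset.univ.filter (fun i => u i ≠ v i)).card with hlt | hge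
        · exact hlt
        · exfalso
          have : (Finset.univ.filter (fun i => u i ≠ v i)).card = k := le_antisymm hge h
          rw [this] at hp
          by_cases hw : wt u % 2 = 1
          · have := hc'.1 hw; omega
          · have : ¬ wt v % 2 = 1 := fun h => hw (hc'.2 h)
            omega
end
end

section
/- Let k ≥ 1 be an integer and let x be an odd integer with 1 ≤ x ≤ 2k. Then N_o(2k, k, x) = N_e(2k, k, x) = (1/2)·C(2k, k), where C(2k,k) is the central binomial coefficient. -/
/-- `N_o(n,k,x) = Σ_{t odd} C(x,t)·C(n−x, k−t)`: the number of `k`-subsets of `{1,…,n}`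
meeting `{n−x+1,…,n}` in an odd number of elements. -/
def Nodd (n k x : ℕ) : ℕ :=
  ∑ t ∈ (Finset.range (k+1)).filter (fun t => Odd t), Nat.choose x t * Nat.choose (n-x) (k-t)

/-- `N_e(n,k,x) = Σ_{t even} C(x,t)·C(n−x, k−t)`: the number of `k`-subsets of `{1,…,n}`
meeting `{n−x+1,…,n}` in an even number of elements. -/
def Neven (n k x : ℕ) : ℕ :=
  ∑ t ∈ (Finset.range (k+1)).filter (fun t => Even t), Nat.choose x t * Nat.choose (n-x) (k-t)

theorem stmt13 (k x : ℕ) (hk : 1 ≤ k) (hx1 : 1 ≤ x) (hx2 : x ≤ 2*k) (hodd : Odd x) :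
    Nodd (2*k) k x = Neven (2*k) k x ∧
    (Nodd (2*k) k x : ℚ) = (1/2 : ℚ) * (Nat.choose (2*k) k : ℚ) := by
  have key : ∀ t, t ≤ k → Nat.choose x t * Nat.choose (2*k-x) (k-t) ≠ 0 →
      t ≤ x ∧ x - t ≤ k ∧ Nat.choose x t * Nat.choose (2*k-x) (k-t)
        = Nat.choose x (x-t) * Nat.choose (2*k-x) (k-(x-t)) := by
    intro t ht h
    have h1 : t ≤ x := by
      by_contra hc
      exact h (by rw [Nat.choose_eq_zero_of_lt (by omega), zero_mul])
    have h2 : k - t ≤ 2*k-x := by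
      by_contra hc
      exact h (by rw [Nat.choose_eq_zero_of_lt (n := 2*k-x) (by omega), mul_zero])
    refine ⟨h1, by omega, ?_⟩
    rw [Nat.choose_symm h1]
    congr 1
    rw [← Nat.choose_symm h2]
    congr 1
    omega
  have heq : Nodd (2*k) k x = Neven (2*k) k x := by
    unfold Nodd Neven
    refine Finset.sum_bij_ne_zero (fun t _ _ => x - t) ?_ ?_ ?_ ?_
    · intro t ht h
      simp only [Finset.mem_filter, Finset.mem_range] at ht ⊢
      obtain ⟨a, b, c⟩ := key t (by omega) h
      exact ⟨by omega, Nat.Odd.sub_odd hodd ht.2⟩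
    · intro t ht h s hs h' e
      simp only [Finset.mem_filter, Finset.mem_range] at ht hs
      obtain ⟨a, b, c⟩ := key t (by omega) h
      obtain ⟨a', b', c'⟩ := key s (by omega) h'
      omega
    · intro t ht h
      simp only [Finset.mem_filter, Finset.mem_range] at ht
      obtain ⟨a, b, c⟩ := key t (by omega) h
      refine ⟨x - t, ?_, ?_, by omega⟩
      · simp only [Finset.mem_filter, Finset.mem_range]
        exact ⟨by omega, Nat.Odd.sub_even a hodd ht.2⟩
      · rw [← c]; exact h
    · intro t ht h
      simp only [Finset.mem_filter, Finset.mem_range] at ht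
      exact (key t (by omega) h).2.2
  have hsum : Nodd (2*k) k x + Neven (2*k) k x = Nat.choose (2*k) k := by
    have h := Nat.add_choose_eq x (2*k-x) k
    rw [Nat.add_sub_cancel' hx2, Finset.Nat.sum_antidiagonal_eq_sum_range_succ_mk] at h
    rw [h, ← Finset.sum_filter_add_sum_filter_not _ (fun t => Odd t)]
    simp only [Nat.not_odd_iff_even]
    rfl
  refine ⟨heq, ?_⟩
  rw [← hsum, ← heq]
  push_cast
  ring
end

section
/- Let k ≥ 1 and n = 2k−1, and let x be an odd integer with 1 ≤ x < n. Then N_e(n, k, x) = N_e(n, k, x+1) and N_o(n, k, x) = N_o(n, k, x+1). -/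
theorem aux1 (w : ℕ → ℕ) (x m K : ℕ) :
    ∑ t ∈ Finset.range (K+2), w t * (x.choose t * (m+1).choose (K+1-t)) =
    ∑ t ∈ Finset.range (K+2), w t * (x.choose t * m.choose (K+1-t)) +
    ∑ t ∈ Finset.range (K+1), w t * (x.choose t * m.choose (K-t)) := by
  rw [Finset.sum_range_succ, Finset.sum_range_succ _ (K+1), add_right_comm,
    ← Finset.sum_add_distrib]
  congr 1
  · apply Finset.sum_congr rfl
    intro t ht
    have ht' : t < K + 1 := Finset.mem_range.mp ht
    have e : K + 1 - t = (K - t) + 1 := by omega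
    rw [e, Nat.choose_succ_succ]
    ring
  · simp

theorem aux2 (w : ℕ → ℕ) (x m K : ℕ) :
    ∑ t ∈ Finset.range (K+2), w t * ((x+1).choose t * m.choose (K+1-t)) =
    ∑ t ∈ Finset.range (K+2), w t * (x.choose t * m.choose (K+1-t)) +
    ∑ t ∈ Finset.range (K+1), w (t+1) * (x.choose t * m.choose (K-t)) := by
  rw [Finset.sum_range_succ', Finset.sum_range_succ' _ (K+1), add_right_comm,
    ← Finset.sum_add_distrib]
  congr 1
  · apply Finset.sum_congr rfl
    intro t ht
    have e : K + 1 - (t + 1) = K - t := by omega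
    rw [e, Nat.choose_succ_succ]
    ring
  · simp

theorem aux3 (w : ℕ → ℕ) (x m K : ℕ) (h : x + m = 2 * K)
    (hw : ∀ t ≤ x, w (x - t + 1) = w t) :
    ∑ t ∈ Finset.range (K+1), w t * (x.choose t * m.choose (K-t)) =
    ∑ t ∈ Finset.range (K+1), w (t+1) * (x.choose t * m.choose (K-t)) := by
  have key : ∀ v : ℕ → ℕ, ∑ t ∈ Finset.range (K+1), v t * (x.choose t * m.choose (K-t)) =
      ∑ t ∈ (Finset.range (K+1)).filter (fun t => t ≤ x ∧ x - t ≤ K),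
        v t * (x.choose t * m.choose (K-t)) := by
    intro v
    symm
    apply Finset.sum_filter_of_ne
    intro t ht hne
    have ht' : t < K + 1 := Finset.mem_range.mp ht
    constructor
    · by_contra hc
      exact hne (by rw [Nat.choose_eq_zero_of_lt (n := x) (by omega)]; simp)
    · by_contra hc
      exact hne (by rw [Nat.choose_eq_zero_of_lt (n := m) (by omega)]; simp)
  rw [key w, key (fun t => w (t+1))]
  apply Finset.sum_nbij' (fun t => x - t) (fun t => x - t)
  · intro t ht
    simp only [Finset.mem_filter, Finset.mem_range] at ht ⊢
    omega
  · intro t ht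
    simp only [Finset.mem_filter, Finset.mem_range] at ht ⊢
    omega
  · intro t ht
    simp only [Finset.mem_filter, Finset.mem_range] at ht
    omega
  · intro t ht
    simp only [Finset.mem_filter, Finset.mem_range] at ht
    omega
  · intro t ht
    simp only [Finset.mem_filter, Finset.mem_range] at ht
    have e : K - (x - t) = m - (K - t) := by omega
    rw [hw t ht.2.1, Nat.choose_symm ht.2.1, e, Nat.choose_symm (by omega)]

theorem aux4 (w : ℕ → ℕ) (x m K : ℕ) (h : x + m = 2 * K)
    (hw : ∀ t ≤ x, w (x - t + 1) = w t) :
    ∑ t ∈ Finset.range (K+2), w t * (x.choose t * (m+1).choose (K+1-t)) =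
    ∑ t ∈ Finset.range (K+2), w t * ((x+1).choose t * m.choose (K+1-t)) := by
  rw [aux1, aux2, aux3 w x m K h hw]

theorem stmt14 (k x : ℕ) (hk : 1 ≤ k) (hx1 : 1 ≤ x) (hx2 : x < 2*k-1) (hodd : Odd x) :
    Neven (2*k-1) k x = Neven (2*k-1) k (x+1) ∧
    Nodd (2*k-1) k x = Nodd (2*k-1) k (x+1) := by
  obtain ⟨K, rfl⟩ : ∃ K, k = K + 1 := ⟨k - 1, by omega⟩
  obtain ⟨m, hm⟩ : ∃ m, x + m = 2 * K := ⟨2 * K - x, by omega⟩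
  have e1 : 2 * (K + 1) - 1 - x = m + 1 := by omega
  have e2 : 2 * (K + 1) - 1 - (x + 1) = m := by omega
  unfold Neven Nodd
  rw [e1, e2]
  simp only [Finset.sum_filter]
  constructor
  · have := aux4 (fun t => if Even t then 1 else 0) x m K hm (by
      intro t ht
      have : Even (x - t + 1) ↔ Even t := by
        rw [Nat.odd_iff] at hodd
        rw [Nat.even_iff, Nat.even_iff]
        omega
      simp only [this])
    simpa only [ite_mul, one_mul, zero_mul] using this
  · have := aux4 (fun t => if Odd t then 1 else 0) x m K hm (by
      intro t ht
      have : Odd (x - t + 1) ↔ Odd t := by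
        rw [Nat.odd_iff] at hodd
        rw [Nat.odd_iff, Nat.odd_iff]
        omega
      simp only [this])
    simpa only [ite_mul, one_mul, zero_mul] using this
end

section
/- Let k, n, x be integers with k ≤ n < 2k and 1 ≤ x ≤ n. If k is odd, then N_e(n, k, x) ≤ C(n−1, k−1); if k is even, then N_o(n, k, x) ≤ C(n−1, k−1). -/
open Polynomial in
noncomputable def FF (y x k : ℕ) : ℤ := ((1 - X : ℤ[X]) ^ y * (1 + X) ^ x).coeff k

open Polynomial in
lemma coeff_omx (y : ℕ) : ∀ s, ((1 - X : ℤ[X]) ^ y).coeff s = (-1) ^ s * (y.choose s : ℤ) := by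
  induction y with
  | zero =>
    intro s
    cases s <;> simp [coeff_one]
  | succ y ih =>
    intro s
    rw [pow_succ, mul_sub, mul_one, coeff_sub, ih]
    cases s with
    | zero => simp
    | succ s =>
      rw [coeff_mul_X, ih, Nat.choose_succ_succ]
      push_cast
      ring

open Polynomial in
lemma FF_x (y x k : ℕ) : FF y (x+1) (k+1) = FF y x (k+1) + FF y x k := by
  unfold FF
  rw [pow_succ (1 + X), ← mul_assoc, mul_add, mul_one, coeff_add, coeff_mul_X]

open Polynomial in
lemma FF_y (y x k : ℕ) : FF (y+1) x (k+1) = FF y x (k+1) - FF y x k := by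
  unfold FF
  rw [pow_succ (1 - X), mul_right_comm, mul_sub, mul_one, coeff_sub, coeff_mul_X]

open Polynomial in
lemma reflect_omx (y : ℕ) : reflect y ((1 - X : ℤ[X]) ^ y) = C ((-1) ^ y) * (1 - X) ^ y := by
  ext i
  rw [coeff_reflect, coeff_C_mul, coeff_omx, coeff_omx]
  by_cases h : i ≤ y
  · rw [revAt_le h, Nat.choose_symm h, ← mul_assoc, ← pow_add]
    congr 1
    obtain ⟨d, rfl⟩ := Nat.exists_eq_add_of_le h
    rw [Nat.add_sub_cancel_left, show i + d + i = d + 2 * i by ring, pow_add, pow_mul]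
    simp
  · rw [revAt_eq_self_of_lt (by omega), Nat.choose_eq_zero_of_lt (by omega)]
    simp

open Polynomial in
lemma reflect_opx (y : ℕ) : reflect y ((1 + X : ℤ[X]) ^ y) = (1 + X) ^ y := by
  ext i
  rw [coeff_reflect, coeff_one_add_X_pow, coeff_one_add_X_pow]
  by_cases h : i ≤ y
  · rw [revAt_le h, Nat.choose_symm h]
  · rw [revAt_eq_self_of_lt (by omega)]

open Polynomial in
lemma FF_symm (y x k l : ℕ) (h : k + l = y + x) : FF y x k = (-1) ^ y * FF y x l := by
  have h1 : reflect (y + x) ((1 - X : ℤ[X]) ^ y * (1 + X) ^ x)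
      = C ((-1) ^ y) * ((1 - X) ^ y * (1 + X) ^ x) := by
    rw [reflect_mul, reflect_omx, reflect_opx, mul_assoc]
    · compute_degree
    · compute_degree
  have h2 := congrArg (fun p => coeff p l) h1
  simp only [coeff_reflect, coeff_C_mul] at h2
  rw [revAt_le (by omega), show y + x - l = k by omega] at h2
  exact h2

open Polynomial in
lemma G_rec (j i : ℕ) :
    (2 * j + 1 : ℤ) * FF (2 * j) (2 * i + 2) (i + j + 1)
      + (2 * i + 1) * FF (2 * j + 2) (2 * i) (i + j + 1) = 0 := by
  have h : C (2 * j + 1 : ℤ) * ((1 - X) ^ (2 * j) * (1 + X) ^ (2 * i + 2))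
      + C (2 * i + 1 : ℤ) * ((1 - X) ^ (2 * j + 2) * (1 + X) ^ (2 * i))
      = C (2 * (i + j + 1) : ℤ) * ((1 - X) ^ (2 * j + 1) * (1 + X) ^ (2 * i + 1))
        - C 2 * (derivative ((1 - X : ℤ[X]) ^ (2 * j + 1) * (1 + X) ^ (2 * i + 1)) * X) := by
    simp only [derivative_mul, derivative_pow, derivative_sub, derivative_add, derivative_one,
      derivative_X, Nat.add_sub_cancel]
    simp only [map_add, map_mul, map_natCast, map_one, map_ofNat]
    push_cast
    ring
  have h2 := congrArg (fun p => coeff p (i + j + 1)) h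
  simp only [coeff_add, coeff_sub, coeff_C_mul, coeff_mul_X, coeff_derivative] at h2
  unfold FF
  rw [h2]
  push_cast
  ring

lemma seq_bound (M : ℕ) (g : ℕ → ℤ)
    (hg : ∀ j, j < M → (2 * j + 1 : ℤ) * g j + (2 * (M:ℤ) - 2 * j - 1) * g (j+1) = 0) :
    ∀ j, 2 * (j + 1) ≤ M + 1 → j + 1 ≤ M → (2 * (M:ℤ) - 1) * |g (j+1)| ≤ |g 0| := by
  have habs : ∀ j, j < M → (2 * j + 1 : ℤ) * |g j| = (2 * (M:ℤ) - 2 * j - 1) * |g (j+1)| := by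
    intro j hj
    have h := hg j hj
    have h3 : (2 * j + 1 : ℤ) * g j = - ((2 * (M:ℤ) - 2 * j - 1) * g (j+1)) := by linarith
    have hpos : (0:ℤ) < 2 * (M:ℤ) - 2 * j - 1 := by omega
    have h4 := congrArg abs h3
    rw [abs_neg, abs_mul, abs_mul, abs_of_pos (by positivity : (0:ℤ) < 2 * j + 1),
      abs_of_pos hpos] at h4
    exact h4
  intro j
  induction j with
  | zero =>
    intro _ h
    have := habs 0 (by omega)
    simp at this
    simp [this]
  | succ j ih =>
    intro h1 h2
    refine le_trans ?_ (ih (by omega) (by omega))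
    have h := habs (j+1) (by omega)
    push_cast at h
    have hM : (2:ℤ) * (j + 2) ≤ M + 1 := by exact_mod_cast h1
    have hle : |g (j+1+1)| ≤ |g (j+1)| := by
      have hp := abs_nonneg (g (j+1))
      have hp2 := abs_nonneg (g (j+1+1))
      have hj : (0:ℤ) ≤ j := by positivity
      by_contra hc
      push Not at hc
      nlinarith
    have : (0:ℤ) ≤ 2 * M - 1 := by
      have hj : (0:ℤ) ≤ j := by positivity
      linarith
    exact mul_le_mul_of_nonneg_left hle this

lemma FF_zero_y (x k : ℕ) : FF 0 x k = x.choose k := by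
  simp [FF, Polynomial.coeff_one_add_X_pow]

lemma FF_zero_x (y k : ℕ) : FF y 0 k = (-1) ^ k * y.choose k := by
  simp [FF, coeff_omx]

lemma G_bound (i j : ℕ) :
    (2 * ((i + j + 2 : ℕ) : ℤ) - 1) * |FF (2 * (j + 1)) (2 * (i + 1)) (i + j + 2)|
      ≤ ((2 * (i + j + 2)).choose (i + j + 2) : ℤ) := by
  obtain ⟨M, hM⟩ : ∃ M, M = i + j + 2 := ⟨_, rfl⟩
  rw [← hM]
  have hrec : ∀ a, a < M → (2 * a + 1 : ℤ) * FF (2 * a) (2 * (M - a)) M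
      + (2 * (M:ℤ) - 2 * a - 1) * FF (2 * (a + 1)) (2 * (M - (a + 1))) M = 0 := by
    intro a ha
    obtain ⟨b, rfl⟩ := Nat.exists_eq_add_of_lt ha
    have := G_rec a b
    rw [show a + b + 1 - a = b + 1 by omega, show a + b + 1 - (a + 1) = b by omega,
      show a + b + 1 = b + a + 1 by omega, show 2 * (b+1) = 2 * b + 2 by ring,
      show 2 * (a+1) = 2 * a + 2 by ring]
    push_cast
    rw [← this]
    ring
  by_cases hc : 2 * (j + 1) ≤ M + 1
  · have := seq_bound M (fun a => FF (2 * a) (2 * (M - a)) M) hrec j hc (by omega)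
    simp only [show M - (j + 1) = i + 1 by omega] at this
    refine this.trans ?_
    simp [FF_zero_y]
  · have := seq_bound M (fun a => FF (2 * (M - a)) (2 * a) M) ?_ i (by omega) (by omega)
    · simp only [show M - (i + 1) = j + 1 by omega] at this
      refine this.trans ?_
      simp [FF_zero_x, abs_mul]
    · intro a ha
      obtain ⟨b, hb⟩ := Nat.exists_eq_add_of_lt ha
      have := hrec b (by omega)
      simp only [show M - a = b + 1 by omega, show M - (a + 1) = b by omega]
      rw [show M - b = a + 1 by omega, show M - (b + 1) = a by omega] at this
      rw [← this, hb]
      push_cast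
      ring

lemma cat_id (m : ℕ) : (2 * m + 1 : ℤ) * (2 * (((2 * m).choose m : ℤ) - (2 * m).choose (m + 1)))
    = ((2 * (m + 1)).choose (m + 1) : ℤ) := by
  have h1 := Nat.succ_mul_centralBinom_succ m
  have h2 := Nat.choose_succ_right_eq (2 * m) m
  rw [show 2 * m - m = m by omega] at h2
  simp only [Nat.centralBinom] at h1
  zify at h1 h2
  have : (m + 1 : ℤ) ≠ 0 := by positivity
  apply mul_left_cancel₀ this
  rw [h1]
  linear_combination (-2 * (2 * m + 1) : ℤ) * h2

lemma central (j i m : ℕ) (h : m = i + j) :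
    2 * (((2 * m).choose (m + 1) : ℤ) - (2 * m).choose m) ≤ FF (2 * j) (2 * (i + 1)) (m + 1) := by
  have hc := cat_id m
  have hp : (0:ℤ) ≤ ((2 * (m + 1)).choose (m + 1) : ℤ) := by positivity
  have hm : (0:ℤ) < 2 * m + 1 := by positivity
  cases j with
  | zero =>
    rw [Nat.mul_zero, FF_zero_y]
    obtain rfl : m = i := by omega
    nlinarith
  | succ j =>
    have hb := G_bound i j
    rw [show i + j + 2 = m + 1 by omega] at hb
    rw [← hc] at hb
    push_cast at hb
    rw [show (2 * ((m:ℤ) + 1) - 1) = 2 * m + 1 by ring] at hb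
    have := le_of_mul_le_mul_left hb hm
    have h3 := (abs_le.1 this).1
    linarith

lemma base (y x m : ℕ) (h : y + x = 2 * m) :
    ((2 * m).choose (m + 1) : ℤ) - (2 * m).choose m ≤ FF y (x + 1) (m + 1) := by
  have hs := FF_symm y (x + 1) (m + 1) m (by omega)
  rcases Nat.even_or_odd' y with ⟨j, rfl | rfl⟩
  · have h1 := FF_x (2 * j) (x + 1) m
    rw [pow_mul] at hs
    have h2 := central j (m - j) m (by omega)
    rw [show 2 * (m - j + 1) = x + 1 + 1 by omega] at h2
    norm_num at hs
    linarith
  · have h1 := FF_y (2 * j + 1) (x + 1) m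
    rw [pow_succ, pow_mul] at hs
    have h2 := central (j + 1) (m - j - 1) m (by omega)
    rw [show 2 * (m - j - 1 + 1) = x + 1 by omega,
      show 2 * (j + 1) = 2 * j + 1 + 1 by ring] at h2
    norm_num at hs
    linarith

lemma mainF (x : ℕ) : ∀ y K, y + x ≤ 2 * K →
    ((y + x).choose (K + 1) : ℤ) - (y + x).choose K ≤ FF y (x + 1) (K + 1) := by
  induction x with
  | zero =>
    intro y K h
    rw [FF_x, FF_zero_x, FF_zero_x]
    have hle : (y.choose (K+1) : ℤ) ≤ y.choose K := by
      have h2 := Nat.choose_succ_right_eq y K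
      have h3 : y - K ≤ K + 1 := by omega
      have : y.choose (K+1) ≤ y.choose K := by
        refine Nat.le_of_mul_le_mul_right (c := K + 1) ?_ (by omega)
        rw [h2]
        exact Nat.mul_le_mul_left _ h3
      exact_mod_cast this
    simp only [add_zero, pow_succ]
    rcases neg_one_pow_eq_or ℤ K with h | h <;> rw [h] <;> linarith
  | succ x ih =>
    intro y K h
    by_cases hb : y + (x + 1) = 2 * K
    · rw [hb]
      exact base y (x + 1) K hb
    · obtain ⟨K, rfl⟩ : ∃ L, K = L + 1 := ⟨K - 1, by omega⟩
      have h1 := ih y (K + 1) (by omega)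
      have h2 := ih y K (by omega)
      rw [FF_x, ← add_assoc, Nat.choose_succ_succ (y + x) (K + 1), Nat.choose_succ_succ (y + x) K]
      push_cast
      linarith

open Polynomial in
lemma FF_sum (y x k : ℕ) : FF y x k
    = ∑ t ∈ Finset.range (k + 1), (-1 : ℤ) ^ (k - t) * (x.choose t * y.choose (k - t)) := by
  unfold FF
  rw [mul_comm, coeff_mul, Finset.Nat.sum_antidiagonal_eq_sum_range_succ_mk]
  refine Finset.sum_congr rfl fun t _ => ?_
  simp only [coeff_omx, coeff_one_add_X_pow]
  ring

lemma final (y x k : ℕ) (p : ℕ → Prop) [DecidablePred p] (hp : ∀ t ≤ k, (p t ↔ Odd (k - t)))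
    (hx : 1 ≤ x) (h : y + x < 2 * k) :
    ∑ t ∈ (Finset.range (k+1)).filter p, Nat.choose x t * Nat.choose y (k-t)
      ≤ (y + x - 1).choose (k - 1) := by
  have hS := FF_sum y x k
  have hT := Nat.add_choose_eq x y k
  rw [Finset.Nat.sum_antidiagonal_eq_sum_range_succ_mk] at hT
  have key : 2 * ((∑ t ∈ (Finset.range (k+1)).filter p,
      Nat.choose x t * Nat.choose y (k-t) : ℕ) : ℤ) = ((x + y).choose k : ℤ) - FF y x k := by
    rw [hS, hT, Finset.sum_filter]
    push_cast
    rw [← Finset.sum_sub_distrib, Finset.mul_sum]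
    refine Finset.sum_congr rfl fun t ht => ?_
    have htk : t ≤ k := by
      have := Finset.mem_range.1 ht
      omega
    by_cases hpt : p t
    · rw [if_pos hpt, ((hp t htk).1 hpt).neg_one_pow]
      ring
    · have he : Even (k - t) := Nat.not_odd_iff_even.1 (fun ho => hpt ((hp t htk).2 ho))
      rw [if_neg hpt, he.neg_one_pow]
      ring
  obtain ⟨x, rfl⟩ : ∃ z, x = z + 1 := ⟨x - 1, by omega⟩
  obtain ⟨k, rfl⟩ : ∃ z, k = z + 1 := ⟨k - 1, by omega⟩
  have hm := mainF x y k (by omega)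
  rw [show x + 1 + y = (y + x) + 1 by ring, Nat.choose_succ_succ] at key
  push_cast at key
  rw [show y + (x + 1) - 1 = y + x by omega, Nat.add_sub_cancel]
  zify
  push_cast
  linarith

theorem stmt15 (n k x : ℕ) (h1 : k ≤ n) (h2 : n < 2*k) (hx1 : 1 ≤ x) (hx2 : x ≤ n) :
    (Odd k → Neven n k x ≤ Nat.choose (n-1) (k-1)) ∧
    (Even k → Nodd n k x ≤ Nat.choose (n-1) (k-1)) := by
  constructor
  · intro hk
    have := final (n - x) x k (fun t => Even t)
      (by intro t ht; rw [Nat.odd_sub ht]; simp [hk]) hx1 (by omega)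
    rwa [show n - x + x - 1 = n - 1 by omega] at this
  · intro hk
    have := final (n - x) x k (fun t => Odd t)
      (by intro t ht
          rw [Nat.odd_sub ht, ← Nat.not_even_iff_odd, ← Nat.not_even_iff_odd]
          simp [hk]) hx1 (by omega)
    rwa [show n - x + x - 1 = n - 1 by omega] at this
end

section
/- Let k, n, m be integers with k, n ≥ 2 and 1 ≤ m ≤ min{n/2, 2k+1}. Then there exists a vertex map f : V(K_{(2kn+n−2m)/(kn−m)}) → V(C_{2k+1}) such that f maps every edge lying in an orbit A_c with c ≥ 2 to an edge of C_{2k+1}, and maps exactly |A_1| − m of the edges in the orbit A_1 to edges of C_{2k+1}; i.e. f has signature (|A_1|−m, |A_2|, …, |A_{⌈(n+1)/2⌉}|). -/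
open scoped Classical

noncomputable section

/-- The orbit `A_c` of the edge-automorphism group of `K_{p/q}`: the edges `v_i v_j` with
`j − i ≡ q + c − 1 (mod p)`. -/
def orbitA (p q c : ℕ) : Finset (Sym2 (Fin p)) :=
  Finset.univ.filter (fun e : Sym2 (Fin p) =>
    e ∈ (circK p q).edgeSet ∧
    ∃ i j : Fin p, e = s(i, j) ∧
      ((j.val : ZMod p) - (i.val : ZMod p) = ((q + c - 1 : ℕ) : ZMod p)))

/-- The `c`-th entry of the signature of a vertex map `f : V(K_{p/q}) → V(H)`: the number of
edges `uv` in the orbit `A_c` with `f(u)f(v)` an edge of `H`. -/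
def sigCount {p : ℕ} {W : Type} (H : SimpleGraph W) (q c : ℕ) (f : Fin p → W) : ℕ :=
  ((orbitA p q c).filter (fun e => Sym2.map f e ∈ H.edgeSet)).card

lemma aux_G_mod (p k x : ℕ) (hx : x < 2 * p) :
    (2 * ((x % p) * (2*k+1) / p)) % (2*k+1) = (2 * (x * (2*k+1) / p)) % (2*k+1) := by
  rcases lt_or_ge x p with h | h
  · rw [Nat.mod_eq_of_lt h]
  · obtain ⟨y, rfl⟩ := Nat.exists_eq_add_of_le h
    have hy : y < p := by omega
    have hp : 0 < p := by omega
    rw [Nat.add_mod_left, Nat.mod_eq_of_lt hy]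
    have : (p + y) * (2*k+1) / p = y * (2*k+1) / p + (2*k+1) := by
      rw [add_mul, Nat.add_comm, Nat.add_mul_div_left _ _ hp]
    rw [this, Nat.mul_add 2 (y * (2*k+1) / p), Nat.add_mul_mod_self_right]

lemma aux_orbit_iff (p q c : ℕ) [NeZero p] (i j : Fin p) :
    ((j.val : ZMod p) - (i.val : ZMod p) = ((q + c - 1 : ℕ) : ZMod p)) ↔
      j.val = (i.val + (q + c - 1)) % p := by
  rw [sub_eq_iff_eq_add, ← Nat.cast_add, ZMod.natCast_eq_natCast_iff, Nat.ModEq,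
    Nat.mod_eq_of_lt j.isLt, Nat.add_comm]

lemma aux_mid (p q k m i d : ℕ) (hp : 0 < p) (hN : (2*k+1) * q + m = k * p) (hm3 : m ≤ 2*k+1)
    (h1 : q + 1 ≤ d) (h2 : d + q + 1 ≤ p) :
    (i + d) * (2*k+1) / p = i * (2*k+1) / p + k ∨
    (i + d) * (2*k+1) / p = i * (2*k+1) / p + k + 1 := by
  have a : i * (2*k+1) / p + k ≤ (i + d) * (2*k+1) / p := by
    rw [← Nat.add_mul_div_right _ _ hp]
    apply Nat.div_le_div_right
    nlinarith
  have b : (i + d) * (2*k+1) / p ≤ i * (2*k+1) / p + (k + 1) := by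
    rw [← Nat.add_mul_div_right _ _ hp]
    apply Nat.div_le_div_right
    nlinarith
  omega

lemma aux_q (p q k m i : ℕ) (hp : 0 < p) (hN : (2*k+1) * q + m = k * p) (hmp : m ≤ p) :
    (i + q) * (2*k+1) / p = i * (2*k+1) / p + k ∨
    (i + q) * (2*k+1) / p + 1 = i * (2*k+1) / p + k := by
  have a : i * (2*k+1) / p + k ≤ (i + q) * (2*k+1) / p + 1 := by
    rw [← Nat.add_mul_div_right _ _ hp, ← Nat.add_div_right _ hp]
    apply Nat.div_le_div_right
    nlinarith
  have b : (i + q) * (2*k+1) / p ≤ i * (2*k+1) / p + k := by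
    rw [← Nat.add_mul_div_right _ _ hp]
    apply Nat.div_le_div_right
    nlinarith
  omega

lemma aux_adj (k a b : ℕ) (hk : 2 ≤ k) (ha : (2*a) % (2*k+1) < 2*k+1)
    (hb : (2*b) % (2*k+1) < 2*k+1) (h : b = a + k ∨ b = a + k + 1) :
    (cycleG (2*k+1)).Adj ⟨(2*a) % (2*k+1), ha⟩ ⟨(2*b) % (2*k+1), hb⟩ := by
  have key : ((2*b) % (2*k+1) + 1) % (2*k+1) = (2*a) % (2*k+1) ∨
      ((2*a) % (2*k+1) + 1) % (2*k+1) = (2*b) % (2*k+1) := by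
    rcases h with rfl | rfl
    · left
      rw [Nat.mod_add_mod, show 2 * (a+k) + 1 = 2*a + (2*k+1) by ring, Nat.add_mod_right]
    · right
      rw [Nat.mod_add_mod, show 2 * (a+k+1) = 2*a + 1 + (2*k+1) by ring, Nat.add_mod_right]
  have hlem : ∀ x, x < 2*k+1 → (x + 1) % (2*k+1) ≠ x := by
    intro x hx hh
    rcases Nat.lt_or_ge (x+1) (2*k+1) with h | h
    · rw [Nat.mod_eq_of_lt h] at hh; omega
    · have : x + 1 = 2*k+1 := by omega
      rw [this, Nat.mod_self] at hh; omega
  rw [cycleG, SimpleGraph.fromRel_adj]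
  refine ⟨?_, key.symm⟩
  intro e
  rw [Fin.mk.injEq] at e
  rcases key with h | h
  · rw [e] at h; exact hlem _ hb h
  · rw [e] at h; exact hlem _ hb h

lemma aux_nadj (k a b : ℕ) (hk : 2 ≤ k) (ha : (2*a) % (2*k+1) < 2*k+1)
    (hb : (2*b) % (2*k+1) < 2*k+1) (h : b + 1 = a + k) :
    ¬ (cycleG (2*k+1)).Adj ⟨(2*a) % (2*k+1), ha⟩ ⟨(2*b) % (2*k+1), hb⟩ := by
  have key : ((2*b) % (2*k+1) + 3) % (2*k+1) = (2*a) % (2*k+1) := by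
    rw [Nat.mod_add_mod, show 2*b + 3 = 2*a + (2*k+1) by omega, Nat.add_mod_right]
  have hmod : ∀ x, x < 2 * (2*k+1) → x % (2*k+1) = if x < 2*k+1 then x else x - (2*k+1) := by
    intro x hx
    split_ifs with h
    · exact Nat.mod_eq_of_lt h
    · rw [Nat.mod_eq_sub_mod (by omega), Nat.mod_eq_of_lt (by omega)]
  rw [cycleG, SimpleGraph.fromRel_adj]
  rintro ⟨-, h'⟩
  simp only at h'
  generalize (2*a) % (2*k+1) = A at *
  generalize (2*b) % (2*k+1) = B at *
  rw [hmod _ (by omega)] at key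
  rw [hmod _ (by omega), hmod _ (by omega)] at h'
  split_ifs at * <;> omega

lemma aux_count (p q k m : ℕ) (hp : 0 < p) (hN : (2*k+1) * q + m = k * p) (hmp : m ≤ p) :
    ((Finset.range p).filter
      (fun i => (i + q) * (2*k+1) / p + 1 = i * (2*k+1) / p + k)).card = m := by
  set F : ℕ → ℕ := fun i => i * (2*k+1) / p with hF
  have hper : ∀ i, F (i + p) = F i + (2*k+1) := by
    intro i
    simp only [hF]
    rw [add_mul, Nat.add_mul_div_left _ _ hp]
  have h1 : ∀ i ∈ Finset.range p,
      F (i + q) + (if F (i+q) + 1 = F i + k then 1 else 0) = F i + k := by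
    intro i _
    rcases aux_q p q k m i hp hN hmp with h | h
    · change F (i+q) = F i + k at h
      rw [if_neg (by omega)]; omega
    · change F (i+q) + 1 = F i + k at h
      rw [if_pos h]; omega
  have h2 := Finset.sum_congr rfl h1
  rw [Finset.sum_add_distrib, Finset.sum_add_distrib, ← Finset.card_filter, Finset.sum_const,
    Finset.card_range, smul_eq_mul] at h2
  have h3 : ∀ r, ∑ i ∈ Finset.range p, F (i + r) = ∑ i ∈ Finset.range p, F i + r * (2*k+1) := by
    intro r
    induction r with
    | zero => simp
    | succ r ih =>
      have e1 := Finset.sum_range_succ (fun i => F (i + r)) p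
      have e2 := Finset.sum_range_succ' (fun i => F (i + r)) p
      have e3 : ∀ i, i + 1 + r = i + (r + 1) := fun i => by ring
      simp only [e3, zero_add] at e2
      have e4 := hper r
      rw [add_comm r p] at e4
      rw [e1, ih, e4] at e2
      rw [add_mul]
      omega
  rw [h3 q] at h2
  change (Finset.filter (fun i => F (i+q) + 1 = F i + k) (Finset.range p)).card = m
  nlinarith

lemma aux_main (p q k n m : ℕ) (hk : 2 ≤ k) (hn : 2 ≤ n) (hq : 0 < q) (hp : p = 2 * q + n)
    (hN : (2*k+1) * q + m = k * p) (hm3 : m ≤ 2*k+1) (hmp : m ≤ p) :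
    ∃ f : Fin p → Fin (2*k+1),
      sigCount (cycleG (2*k+1)) q 1 f = (orbitA p q 1).card - m ∧
      ∀ c, 2 ≤ c → c ≤ (n+2)/2 →
        sigCount (cycleG (2*k+1)) q c f = (orbitA p q c).card := by
  have hp0 : 0 < p := by omega
  haveI : NeZero p := ⟨hp0.ne'⟩
  have hlt : ∀ x, (2 * x) % (2*k+1) < 2*k+1 := fun x => Nat.mod_lt _ (by omega)
  let f : Fin p → Fin (2*k+1) := fun i => ⟨(2 * (i.val * (2*k+1) / p)) % (2*k+1), hlt _⟩
  have hf : ∀ (i j : Fin p) (d : ℕ), d < p → j.val = (i.val + d) % p →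
      f j = ⟨(2 * ((i.val + d) * (2*k+1) / p)) % (2*k+1), hlt _⟩ := by
    intro i j d hd hj
    apply Fin.ext
    change (2 * (j.val * (2*k+1) / p)) % (2*k+1) = _
    rw [hj]
    exact aux_G_mod p k _ (by omega)
  refine ⟨f, ?_, ?_⟩
  · let s : Fin p → Fin p := fun i => ⟨(i.val + q) % p, Nat.mod_lt _ hp0⟩
    have hs : ∀ i, (s i).val = i.val + q ∨ (s i).val + p = i.val + q := by
      intro i
      change (i.val + q) % p = _ ∨ (i.val + q) % p + p = _
      rcases Nat.lt_or_ge (i.val + q) p with h | h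
      · left; exact Nat.mod_eq_of_lt h
      · right
        rw [Nat.mod_eq_sub_mod h, Nat.mod_eq_of_lt (by omega)]; omega
    let E : Fin p → Sym2 (Fin p) := fun i => s(i, s i)
    have hE : Function.Injective E := by
      intro i j h
      have h' : s(i, s i) = s(j, s j) := h
      rw [Sym2.eq_iff] at h'
      rcases h' with h' | ⟨h1, h2⟩
      · exact h'.1
      · exfalso
        have a := hs i
        have b := hs j
        have c := congrArg Fin.val h1
        have d := congrArg Fin.val h2
        have := i.isLt
        have := j.isLt
        omega
    have horb : orbitA p q 1 = Finset.univ.image E := by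
      ext e
      simp only [orbitA, Finset.mem_filter, Finset.mem_univ, true_and, Finset.mem_image]
      constructor
      · rintro ⟨-, i, j, rfl, h⟩
        rw [aux_orbit_iff] at h
        refine ⟨i, ?_⟩
        have : s i = j := Fin.ext h.symm
        change s(i, s i) = _
        rw [this]
      · rintro ⟨i, rfl⟩
        refine ⟨?_, i, s i, rfl, ?_⟩
        · change s(i, s i) ∈ _
          rw [SimpleGraph.mem_edgeSet, circK, SimpleGraph.fromRel_adj]
          have a := hs i
          have := i.isLt
          have := (s i).isLt
          refine ⟨?_, Or.inl ?_⟩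
          · intro h
            have := congrArg Fin.val h
            omega
          · omega
        · rw [aux_orbit_iff]; rfl
    have hadj : ∀ i, Sym2.map f (E i) ∈ (cycleG (2*k+1)).edgeSet ↔
        ¬ ((i.val + q) * (2*k+1) / p + 1 = i.val * (2*k+1) / p + k) := by
      intro i
      change Sym2.map f s(i, s i) ∈ _ ↔ _
      rw [Sym2.map_mk, SimpleGraph.mem_edgeSet, hf i (s i) q (by omega) rfl]
      rcases aux_q p q k m i.val hp0 hN hmp with h | h
      · exact ⟨fun _ => by omega, fun _ => aux_adj k _ _ hk _ _ (Or.inl h)⟩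
      · exact ⟨fun h' => absurd h' (aux_nadj k _ _ hk _ _ h), fun h' => absurd h h'⟩
    have hbad : (Finset.univ.filter (fun i : Fin p =>
        (i.val + q) * (2*k+1) / p + 1 = i.val * (2*k+1) / p + k)).card = m := by
      rw [← aux_count p q k m hp0 hN hmp, ← Finset.card_map Fin.valEmbedding]
      congr 1
      ext x
      simp only [Finset.mem_map, Finset.mem_filter, Finset.mem_univ, true_and, Finset.mem_range,
        Fin.valEmbedding_apply]
      constructor
      · rintro ⟨a, ha, rfl⟩
        exact ⟨a.isLt, ha⟩
      · rintro ⟨hx, h⟩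
        exact ⟨⟨x, hx⟩, h, rfl⟩
    rw [sigCount, horb, Finset.filter_image, Finset.card_image_of_injective _ hE,
      Finset.card_image_of_injective _ hE]
    simp only [hadj]
    have := Finset.card_filter_add_card_filter_not (s := (Finset.univ : Finset (Fin p)))
      (fun i : Fin p => (i.val + q) * (2*k+1) / p + 1 = i.val * (2*k+1) / p + k)
    rw [hbad] at this
    omega
  · intro c hc1 hc2
    rw [sigCount, Finset.filter_true_of_mem]
    intro e he
    simp only [orbitA, Finset.mem_filter, Finset.mem_univ, true_and] at he
    obtain ⟨-, i, j, rfl, h⟩ := he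
    rw [aux_orbit_iff] at h
    rw [Sym2.map_mk, SimpleGraph.mem_edgeSet, hf i j (q + c - 1) (by omega) h]
    exact aux_adj k _ _ hk _ _ (aux_mid p q k m i.val (q+c-1) hp0 hN hm3 (by omega) (by omega))

theorem stmt18 (k n m : ℕ) (hk : 2 ≤ k) (hn : 2 ≤ n)
    (hm1 : 1 ≤ m) (hm2 : 2*m ≤ n) (hm3 : m ≤ 2*k+1) :
    ∃ f : Fin (2*k*n + n - 2*m) → Fin (2*k+1),
      sigCount (cycleG (2*k+1)) (k*n - m) 1 f =
        (orbitA (2*k*n + n - 2*m) (k*n - m) 1).card - m ∧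
      ∀ c, 2 ≤ c → c ≤ (n+2)/2 →
        sigCount (cycleG (2*k+1)) (k*n - m) c f =
          (orbitA (2*k*n + n - 2*m) (k*n - m) c).card := by
  have hnk : 2 * n ≤ k * n := Nat.mul_le_mul_right n hk
  obtain ⟨q, hq⟩ : ∃ q, k * n = q + m := ⟨k * n - m, by omega⟩
  have e1 : k * n - m = q := by omega
  have e2 : 2 * k * n + n - 2 * m = 2 * q + n := by
    rw [mul_assoc]; omega
  rw [e1, e2]
  refine aux_main (2 * q + n) q k n m hk hn (by omega) rfl ?_ hm3 (by omega)
  nlinarith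
end
end
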